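/- arXiv:2507.07278 — 8 statements merged into one kernel-verified Lean document; each statement's English description precedes it below -/
import Mathlib

section
/- Let k be a field and let p ∈ k[X] be a polynomial satisfying p(−1−X) = p(X) (i.e., p is invariant under the substitution X ↦ −1−X). Then there exists a polynomial q ∈ k[X] such that p(X) = q(X² + X). -/
open Polynomial

/-- If `p ∈ k[X]` satisfies `p(−1−X) = p(X)`, then `p(X) = q(X² + X)` for some `q ∈ k[X]`. -/
theorem exists_comp_of_invariant {k : Type*} [Field k] (p : Polynomial k)
    (h : p.comp (-1 - X) = p) :
    ∃ q : Polynomial k, p = q.comp (X ^ 2 + X) := by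
  induction hn : p.natDegree using Nat.strong_induction_on generalizing p with
  | _ n ih =>
  have hroot : p.eval (-1) = p.eval 0 := by
    simpa [eval_comp] using congrArg (eval 0) h
  obtain ⟨s, hs⟩ : X - C 0 ∣ p - C (p.eval 0) := X_sub_C_dvd_sub_C_eval
  have hs_root : s.IsRoot (-1) := by
    simpa [hroot] using congrArg (eval (-1)) hs
  obtain ⟨t, rfl⟩ := dvd_iff_isRoot.2 hs_root
  have hm : (X ^ 2 + X : k[X]).Monic := by monicity!
  have hp : p = (X ^ 2 + X) * t + C (p.eval 0) := by
    rw [← sub_eq_iff_eq_add, hs]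
    simp only [map_zero, map_neg, map_one]
    ring
  have ht : t.comp (-1 - X) = t := by
    have hmt : (X ^ 2 + X) * t.comp (-1 - X) = (X ^ 2 + X) * t := by
      have h' := h
      rw [hp] at h'
      simp only [add_comp, mul_comp, pow_comp, X_comp, C_comp] at h'
      linear_combination h'
    exact mul_left_cancel₀ hm.ne_zero hmt
  by_cases ht0 : t = 0
  · exact ⟨C (p.eval 0), by simpa [ht0] using hp⟩
  have hdeg : t.natDegree < n := by
    have hm2 : (X ^ 2 + X : k[X]).natDegree = 2 := by compute_degree!
    rw [← hn, hp, natDegree_add_C, hm.natDegree_mul' ht0, hm2]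
    omega
  obtain ⟨q, hq⟩ := ih _ hdeg t ht rfl
  refine ⟨X * q + C (p.eval 0), ?_⟩
  simpa [← hq] using hp
end

section
/- Set λ = 64·f₀ − 20·f₁ + 4·f₂ − f₃ + 16·g₀² − 8·g₀·g₁ + g₁². Assume (x, y) ∈ k² satisfies the C₂²-model equation and 2x+1 ≠ 0. Then the pair (X, Y) = (−λ·x·(x+1)/(2x+1)², λ·(y + (x+1)·(g₁·x·(x+1) + g₀))/(2x+1)³) satisfies the Weierstrass equation Y² + ((g₁ − 4g₀)·X − λ·g₀)·Y = X³ + (48·f₀ − 9·f₁ + f₂ + 8·g₀² − 2·g₀·g₁)·X² + λ·(12·f₀ − f₁ + g₀²)·X + λ²·f₀ (the equation of the quotient elliptic curve E₂ = C/⟨ισ⟩). -/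
/-- If `(x, y)` lies on the C₂²-model curve and `2x+1 ≠ 0`, then
`(X, Y) = (−λ·x·(x+1)/(2x+1)², λ·(y + (x+1)·(g₁·x·(x+1) + g₀))/(2x+1)³)` lies on the
Weierstrass model of the quotient elliptic curve `E₂ = C/⟨ισ⟩`. -/
theorem quotient_E2 {k : Type*} [Field k] (g₀ g₁ f₀ f₁ f₂ f₃ : k) (x y : k)
    (hx : 2 * x + 1 ≠ 0)
    (h : y ^ 2 + (g₁ * x * (x + 1) + g₀) * y =
      f₃ * x ^ 3 * (x + 1) ^ 3 + (f₂ - f₁) * x ^ 2 * (x + 1) ^ 2 + f₁ * x * (x + 1) + f₀) :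
    let l := 64 * f₀ - 20 * f₁ + 4 * f₂ - f₃ + 16 * g₀ ^ 2 - 8 * g₀ * g₁ + g₁ ^ 2
    let X := -l * x * (x + 1) / (2 * x + 1) ^ 2
    let Y := l * (y + (x + 1) * (g₁ * x * (x + 1) + g₀)) / (2 * x + 1) ^ 3
    Y ^ 2 + ((g₁ - 4 * g₀) * X - l * g₀) * Y =
      X ^ 3 + (48 * f₀ - 9 * f₁ + f₂ + 8 * g₀ ^ 2 - 2 * g₀ * g₁) * X ^ 2 +
        l * (12 * f₀ - f₁ + g₀ ^ 2) * X + l ^ 2 * f₀ := by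
  intro l X Y
  have hX : X * (2 * x + 1) ^ 2 = -l * x * (x + 1) := div_mul_cancel₀ _ (pow_ne_zero 2 hx)
  have hY : Y * (2 * x + 1) ^ 3 = l * (y + (x + 1) * (g₁ * x * (x + 1) + g₀)) :=
    div_mul_cancel₀ _ (pow_ne_zero 3 hx)
  have hl : l = 64 * f₀ - 20 * f₁ + 4 * f₂ - f₃ + 16 * g₀ ^ 2 - 8 * g₀ * g₁ + g₁ ^ 2 := rfl
  clear_value X Y l
  apply mul_right_cancel₀ (pow_ne_zero 6 hx)
  calc
    _ = (Y * (2 * x + 1) ^ 3) ^ 2 + ((g₁ - 4 * g₀) * (X * (2 * x + 1) ^ 2)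
          - l * g₀ * (2 * x + 1) ^ 2) * (2 * x + 1) * (Y * (2 * x + 1) ^ 3) := by ring
    _ = (X * (2 * x + 1) ^ 2) ^ 3
        + (48 * f₀ - 9 * f₁ + f₂ + 8 * g₀ ^ 2 - 2 * g₀ * g₁) * (X * (2 * x + 1) ^ 2) ^ 2
          * (2 * x + 1) ^ 2
        + l * (12 * f₀ - f₁ + g₀ ^ 2) * (X * (2 * x + 1) ^ 2) * (2 * x + 1) ^ 4
        + l ^ 2 * f₀ * (2 * x + 1) ^ 6 := by
      rw [hX, hY]
      linear_combination l ^ 2 * h + l ^ 2 * (x * (x + 1)) ^ 3 * hl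
    _ = _ := by ring
end

section
/- Let k be a field, g₀, g₁, f₀, f₁, f₂ ∈ k, and define g(x) = g₀·x³ − (g₁+3g₀)·x² + g₁·x + g₀ and f(x) = f₀·x⁶ − (f₁+6f₀)·x⁵ + (f₂+5f₁+15f₀)·x⁴ − (2f₂+5f₁+10f₀)·x³ + f₂·x² + f₁·x + f₀. If x, y ∈ k satisfy x ≠ 1 and y² + g(x)·y = f(x), then setting x' = 1/(1−x) and y' = y/(x−1)³ one has y'² + g(x')·y' = f(x'). (In other words, the substitution τ₃ : (x,y) ↦ (1/(1−x), y/(x−1)³) preserves the D₆-model curve.) -/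
/-- The substitution `τ₃ : (x,y) ↦ (1/(1−x), y/(x−1)³)` preserves the D₆-model curve
`y² + g(x)·y = f(x)`. -/
theorem d6_model_invariant {k : Type*} [Field k] (g₀ g₁ f₀ f₁ f₂ : k) :
    let g : k → k := fun x => g₀ * x ^ 3 - (g₁ + 3 * g₀) * x ^ 2 + g₁ * x + g₀
    let f : k → k := fun x => f₀ * x ^ 6 - (f₁ + 6 * f₀) * x ^ 5 + (f₂ + 5 * f₁ + 15 * f₀) * x ^ 4
      - (2 * f₂ + 5 * f₁ + 10 * f₀) * x ^ 3 + f₂ * x ^ 2 + f₁ * x + f₀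
    ∀ x y : k, x ≠ 1 → y ^ 2 + g x * y = f x →
      (y / (x - 1) ^ 3) ^ 2 + g (1 / (1 - x)) * (y / (x - 1) ^ 3) = f (1 / (1 - x)) := by
  intro g f x y hx h
  have hu : x - 1 ≠ 0 := sub_ne_zero.mpr hx
  have hinv : 1 / (1 - x) = -(x - 1)⁻¹ := by
    rw [← neg_sub x 1, one_div, inv_neg]
  have hg : g (1 / (1 - x)) = g x / (x - 1) ^ 3 := by
    simp only [g, hinv]
    field_simp
    ring
  have hf : f (1 / (1 - x)) = f x / (x - 1) ^ 6 := by
    simp only [f, hinv]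
    field_simp
    ring
  rw [hg, hf, ← h]
  field_simp
end

section
/- Let ν₁ ∈ k satisfy ν₁² = λ₂(λ₁ − 1)/(λ₁ − λ₂). If x, y ∈ k satisfy y² = (x² − 1)(x² − a)(x² − b), then the pair (X, Y) = (ν₁²·(x² − b), ν₁³·y) satisfies Y² = X(X − 1)(X − λ₁); that is, the map ρ₁ sends points of C_{λ₁,λ₂} to points of the Legendre elliptic curve E_{λ₁}. -/
/-- The map `ρ₁ : (x,y) ↦ (ν₁²(x² − b), ν₁³y)` sends points of the curve `C_{λ₁,λ₂}` to
points of the Legendre elliptic curve `E_{λ₁} : Y² = X(X − 1)(X − λ₁)`. -/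
theorem rho1_maps_to_legendre {k : Type*} [Field k] (h2 : (2 : k) ≠ 0)
    (l₁ l₂ : k) (h₁0 : l₁ ≠ 0) (h₁1 : l₁ ≠ 1) (h₂0 : l₂ ≠ 0) (h₂1 : l₂ ≠ 1) (hne : l₁ ≠ l₂)
    (ν₁ : k) (hν₁ : ν₁ ^ 2 = l₂ * (l₁ - 1) / (l₁ - l₂)) (x y : k)
    (h : y ^ 2 = (x ^ 2 - 1) * (x ^ 2 - l₁ / l₂) * (x ^ 2 - l₁ * (l₂ - 1) / (l₂ * (l₁ - 1)))) :
    let X := ν₁ ^ 2 * (x ^ 2 - l₁ * (l₂ - 1) / (l₂ * (l₁ - 1)))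
    let Y := ν₁ ^ 3 * y
    Y ^ 2 = X * (X - 1) * (X - l₁) := by
  have h₁1' : l₁ - 1 ≠ 0 := sub_ne_zero.mpr h₁1
  have hne' : l₁ - l₂ ≠ 0 := sub_ne_zero.mpr hne
  intro X Y
  have hX1 : X - 1 = ν₁ ^ 2 * (x ^ 2 - 1) := by
    simp only [X, hν₁]
    field_simp
    ring
  have hXl : X - l₁ = ν₁ ^ 2 * (x ^ 2 - l₁ / l₂) := by
    simp only [X, hν₁]
    field_simp
    ring
  rw [hX1, hXl]
  simp only [X, Y, mul_pow, h]
  ring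
end

section
/- Let ν₂, w ∈ k satisfy ν₂² = λ₁(λ₂ − 1)/(λ₁ − λ₂) and w² = (λ₁ − 1)/(λ₂ − 1). If x, y ∈ k satisfy x ≠ 0 and y² = (x² − 1)(x² − a)(x² − b), then the pair (X, Y) = (−ν₂²·(1/x² − λ₂(λ₁ − 1)/(λ₁(λ₂ − 1))), ν₂³·λ₂·w·y/(λ₁·x³)) satisfies Y² = X(X − 1)(X − λ₂); that is, the map ρ₂ sends points of C_{λ₁,λ₂} to points of the Legendre elliptic curve E_{λ₂}. -/
/-- The map `ρ₂ : (x,y) ↦ (−ν₂²(1/x² − λ₂(λ₁−1)/(λ₁(λ₂−1))), ν₂³λ₂wy/(λ₁x³))` sends points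
of the curve `C_{λ₁,λ₂}` to points of the Legendre elliptic curve
`E_{λ₂} : Y² = X(X − 1)(X − λ₂)`. -/
theorem rho2_maps_to_legendre {k : Type*} [Field k] (h2 : (2 : k) ≠ 0)
    (l₁ l₂ : k) (h₁0 : l₁ ≠ 0) (h₁1 : l₁ ≠ 1) (h₂0 : l₂ ≠ 0) (h₂1 : l₂ ≠ 1) (hne : l₁ ≠ l₂)
    (ν₂ w : k) (hν₂ : ν₂ ^ 2 = l₁ * (l₂ - 1) / (l₁ - l₂)) (hw : w ^ 2 = (l₁ - 1) / (l₂ - 1))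
    (x y : k) (hx : x ≠ 0)
    (h : y ^ 2 = (x ^ 2 - 1) * (x ^ 2 - l₁ / l₂) * (x ^ 2 - l₁ * (l₂ - 1) / (l₂ * (l₁ - 1)))) :
    let X := -(ν₂ ^ 2) * (1 / x ^ 2 - l₂ * (l₁ - 1) / (l₁ * (l₂ - 1)))
    let Y := ν₂ ^ 3 * l₂ * w * y / (l₁ * x ^ 3)
    Y ^ 2 = X * (X - 1) * (X - l₂) := by
  intro X Y
  have hd : l₁ - l₂ ≠ 0 := sub_ne_zero.mpr hne
  have h₁ : l₁ - 1 ≠ 0 := sub_ne_zero.mpr h₁1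
  have h₂ : l₂ - 1 ≠ 0 := sub_ne_zero.mpr h₂1
  have hX : X = ν₂ ^ 2 * (l₂ * (l₁ - 1) / (l₁ * (l₂ - 1)) - 1 / x ^ 2) := by
    simp only [X]
    ring
  have hX₁ : X - 1 = ν₂ ^ 2 * (1 - 1 / x ^ 2) := by
    rw [hX, hν₂]
    field_simp
    ring
  have hX₂ : X - l₂ = ν₂ ^ 2 * (l₂ / l₁ - 1 / x ^ 2) := by
    rw [hX, hν₂]
    field_simp
    ring
  have hY : Y ^ 2 = (ν₂ ^ 2) ^ 3 * l₂ ^ 2 * w ^ 2 * y ^ 2 / (l₁ ^ 2 * x ^ 6) := by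
    simp only [Y]
    ring
  rw [hY, hX₂, hX₁, hX, hw, h]
  field_simp
end

section
/- For x ∈ k with x ≠ 0 and λ₂·x² ≠ λ₁, set X₁ = (λ₂(λ₁ − 1)/(λ₁ − λ₂))·(x² − b) and X₂ = −(λ₁(λ₂ − 1)/(λ₁ − λ₂))·(1/x² − λ₂(λ₁ − 1)/(λ₁(λ₂ − 1))). Then X₁ ≠ λ₁, X₂ ≠ λ₂, and (1 − λ₁)·X₁/(X₁ − λ₁) = (1 − λ₂)·X₂/(X₂ − λ₂) = (λ₂(1 − λ₁)·x² − λ₁(1 − λ₂))/(λ₂·x² − λ₁); that is, the compositions ψ₁'∘ρ₁ and ψ₂'∘ρ₂ of the quotient maps from C_{λ₁,λ₂} with the degree-two maps ψ_i'(X,Y) = (1 − λ_i)·X/(X − λ_i) to ℙ¹ coincide and are given by the displayed rational function of x. -/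
/-- The compositions `ψ₁'∘ρ₁` and `ψ₂'∘ρ₂` of the quotient maps from `C_{λ₁,λ₂}` with the
degree-two maps `ψᵢ'(X,Y) = (1 − λᵢ)X/(X − λᵢ)` to `ℙ¹` coincide, and are given by the
rational function `(λ₂(1 − λ₁)x² − λ₁(1 − λ₂))/(λ₂x² − λ₁)`. -/
theorem psi_compositions_agree {k : Type*} [Field k] (h2 : (2 : k) ≠ 0)
    (l₁ l₂ : k) (h₁0 : l₁ ≠ 0) (h₁1 : l₁ ≠ 1) (h₂0 : l₂ ≠ 0) (h₂1 : l₂ ≠ 1) (hne : l₁ ≠ l₂)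
    (x : k) (hx : x ≠ 0) (hx' : l₂ * x ^ 2 ≠ l₁) :
    let b := l₁ * (l₂ - 1) / (l₂ * (l₁ - 1))
    let X₁ := l₂ * (l₁ - 1) / (l₁ - l₂) * (x ^ 2 - b)
    let X₂ := -(l₁ * (l₂ - 1) / (l₁ - l₂)) * (1 / x ^ 2 - l₂ * (l₁ - 1) / (l₁ * (l₂ - 1)))
    X₁ ≠ l₁ ∧ X₂ ≠ l₂ ∧
      (1 - l₁) * X₁ / (X₁ - l₁) =
        (l₂ * (1 - l₁) * x ^ 2 - l₁ * (1 - l₂)) / (l₂ * x ^ 2 - l₁) ∧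
      (1 - l₂) * X₂ / (X₂ - l₂) =
        (l₂ * (1 - l₁) * x ^ 2 - l₁ * (1 - l₂)) / (l₂ * x ^ 2 - l₁) := by
  intro b X₁ X₂
  have hd : l₁ - l₂ ≠ 0 := sub_ne_zero.mpr hne
  have hl₁ : l₁ - 1 ≠ 0 := sub_ne_zero.mpr h₁1
  have hl₂ : l₂ - 1 ≠ 0 := sub_ne_zero.mpr h₂1
  have hD : l₂ * x ^ 2 - l₁ ≠ 0 := sub_ne_zero.mpr hx'
  have hX₁ : X₁ = (l₂ * (l₁ - 1) * x ^ 2 - l₁ * (l₂ - 1)) / (l₁ - l₂) := by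
    simp only [X₁, b]
    field_simp
  have hX₂ : X₂ = (l₂ * (l₁ - 1) * x ^ 2 - l₁ * (l₂ - 1)) / ((l₁ - l₂) * x ^ 2) := by
    simp only [X₂]
    field_simp
    ring
  have hs₁ : X₁ - l₁ = (l₁ - 1) * (l₂ * x ^ 2 - l₁) / (l₁ - l₂) := by
    rw [hX₁]
    field_simp
    ring
  have hs₂ : X₂ - l₂ = (l₂ - 1) * (l₂ * x ^ 2 - l₁) / ((l₁ - l₂) * x ^ 2) := by
    rw [hX₂]
    field_simp
    ring
  refine ⟨sub_ne_zero.mp ?_, sub_ne_zero.mp ?_, ?_, ?_⟩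
  · rw [hs₁]
    exact div_ne_zero (mul_ne_zero hl₁ hD) hd
  · rw [hs₂]
    exact div_ne_zero (mul_ne_zero hl₂ hD) (mul_ne_zero hd (pow_ne_zero 2 hx))
  · rw [hs₁, hX₁]
    field_simp
    ring
  · rw [hs₂, hX₂]
    field_simp
    ring
end

section
/- (i) Let x₀, x₁, x₂ ∈ R and set J₂ = x₀, J₄ = x₀·x₁, J₆ = x₀·x₁², J₈ = x₀³·x₂, J₁₀ = x₁·(x₀·x₁³ + x₁⁴ + x₀³·x₂); then (J₂⁴, J₂²·J₄, J₈) = (x₀³·x₀, x₀³·x₁, x₀³·x₂), i.e. the inverse map recovers (x₀, x₁, x₂) up to the common projective scalar x₀³. (ii) Conversely, let J₂, J₄, J₆, J₈, J₁₀ ∈ R satisfy J₄² = J₂·J₆ and h₈ = 0, and set (y₀, y₁, y₂) = (J₂⁴, J₂²·J₄, J₈); then (y₀, y₀·y₁, y₀·y₁², y₀³·y₂, y₁·(y₀·y₁³ + y₁⁴ + y₀³·y₂)) = ((J₂³)·J₂, (J₂³)²·J₄, (J₂³)³·J₆, (J₂³)⁴·J₈, (J₂³)⁵·J₁₀), i.e.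 the forward map recovers the weighted projective point [J₂ : J₄ : J₆ : J₈ : J₁₀] of ℙ(1,2,3,4,5) up to the weighted scalar J₂³. (Together these establish that in characteristic two the stratum W_{≥C₂²} is rational.) -/
/-- In characteristic two, the parametrisation
`[x₀ : x₁ : x₂] ↦ [x₀ : x₀x₁ : x₀x₁² : x₀³x₂ : x₁(x₀x₁³ + x₁⁴ + x₀³x₂)]` and the map
`[J₂ : J₄ : J₆ : J₈ : J₁₀] ↦ [J₂⁴ : J₂²J₄ : J₈]` are mutually inverse up to projective
rescaling, establishing the rationality of the stratum `W_{≥C₂²}`. -/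
theorem char2_stratum_rational {R : Type*} [CommRing R] [CharP R 2] :
    (∀ x₀ x₁ x₂ : R,
      let J₂ := x₀
      let J₄ := x₀ * x₁
      let J₈ := x₀ ^ 3 * x₂
      J₂ ^ 4 = x₀ ^ 3 * x₀ ∧ J₂ ^ 2 * J₄ = x₀ ^ 3 * x₁ ∧ J₈ = x₀ ^ 3 * x₂) ∧
    (∀ J₂ J₄ J₆ J₈ J₁₀ : R, J₄ ^ 2 = J₂ * J₆ →
      J₄ ^ 4 + J₄ * J₆ ^ 2 + J₂ ^ 2 * J₄ * J₈ + J₂ ^ 3 * J₁₀ = 0 →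
      let y₀ := J₂ ^ 4
      let y₁ := J₂ ^ 2 * J₄
      let y₂ := J₈
      y₀ = J₂ ^ 3 * J₂ ∧
        y₀ * y₁ = (J₂ ^ 3) ^ 2 * J₄ ∧
        y₀ * y₁ ^ 2 = (J₂ ^ 3) ^ 3 * J₆ ∧
        y₀ ^ 3 * y₂ = (J₂ ^ 3) ^ 4 * J₈ ∧
        y₁ * (y₀ * y₁ ^ 3 + y₁ ^ 4 + y₀ ^ 3 * y₂) = (J₂ ^ 3) ^ 5 * J₁₀) := by
  have two_eq_zero : (2 : R) = 0 := CharTwo.two_eq_zero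
  refine ⟨fun x₀ x₁ x₂ => ⟨by ring, by ring, rfl⟩, ?_⟩
  intro J₂ J₄ J₆ J₈ J₁₀ hJ h₈ y₀ y₁ y₂
  refine ⟨by ring, by ring, ?_, by ring, ?_⟩
  · linear_combination J₂ ^ 8 * hJ
  · linear_combination J₂ ^ 12 * h₈ + J₂ ^ 10 * J₄ * (J₄ ^ 2 + J₂ * J₆) * hJ -
      J₂ ^ 15 * J₁₀ * two_eq_zero
end

section
/- Let k be a field. (i) A cubic polynomial g = c₃X³ + c₂X² + c₁X + c₀ ∈ k[X] satisfies the invariance condition c₀(X−1)³ − c₁(X−1)² + c₂(X−1) − c₃ = g (i.e. (X−1)³·g(1/(1−X)) = g(X)) if and only if c₃ = c₀ and c₂ = −(c₁ + 3c₀), i.e. iff g = g₀X³ − (g₁+3g₀)X² + g₁X + g₀ for some g₀, g₁ ∈ k. (ii) A sextic polynomial f = Σᵢ aᵢXⁱ of degree ≤ 6 satisfies Σᵢ aᵢ(−1)ⁱ(X−1)^{6−i} = f (i.e. (X−1)⁶·f(1/(1−X)) = f(X)) if and only if f = f₀X⁶ − (f₁+6f₀)X⁵ + (f₂+5f₁+15f₀)X⁴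 − (2f₂+5f₁+10f₀)X³ + f₂X² + f₁X + f₀ for some f₀, f₁, f₂ ∈ k. (These characterisations show every genus-two curve admitting the order-three automorphism τ₃ : (x,y) ↦ (1/(1−x), y/(x−1)³) can be written in the D₆-model form.) -/
open Polynomial Finset

theorem sum_fin_C_mul_X_pow_inj {R : Type*} [Semiring R] {n : ℕ} {a b : Fin n → R} :
    (∑ i : Fin n, C (a i) * X ^ (i : ℕ) = ∑ i : Fin n, C (b i) * X ^ (i : ℕ)) ↔ a = b := by
  refine ⟨fun h => ?_, fun h => by rw [h]⟩
  funext j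
  have hj := congrArg (fun p : R[X] => p.coeff j) h
  simpa [finsetSum_coeff, coeff_C_mul, coeff_X_pow, Fin.val_inj] using hj

theorem twisted_cubic_expand {R : Type*} [CommRing R] (c₀ c₁ c₂ c₃ : R) :
    C c₀ * (X - 1) ^ 3 - C c₁ * (X - 1) ^ 2 + C c₂ * (X - 1) - C c₃ =
      ∑ i : Fin 4, C (![-c₀ - c₁ - c₂ - c₃, 3 * c₀ + 2 * c₁ + c₂, -3 * c₀ - c₁, c₀] i) *
        X ^ (i : ℕ) := by
  simp [Fin.sum_univ_four, map_ofNat C]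
  ring

theorem twisted_sextic_expand {R : Type*} [CommRing R] (a : Fin 7 → R) :
    ∑ i : Fin 7, C (a i) * (-1) ^ (i : ℕ) * (X - 1) ^ (6 - (i : ℕ)) =
      ∑ i : Fin 7, C (![a 0 + a 1 + a 2 + a 3 + a 4 + a 5 + a 6,
        -6 * a 0 - 5 * a 1 - 4 * a 2 - 3 * a 3 - 2 * a 4 - a 5,
        15 * a 0 + 10 * a 1 + 6 * a 2 + 3 * a 3 + a 4,
        -20 * a 0 - 10 * a 1 - 4 * a 2 - a 3,
        15 * a 0 + 5 * a 1 + a 2, -6 * a 0 - a 1, a 0] i) * X ^ (i : ℕ) := by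
  simp [Fin.sum_univ_seven, map_ofNat C]
  ring

/-- Characterisation of the cubics and sextics invariant under the twisted substitution
`p(X) ↦ (X−1)^d·p(1/(1−X))`: these are precisely the polynomials `g` and `f` appearing in
the D₆-model `y² + g(x)y = f(x)` of a genus-two curve with the order-three automorphism
`τ₃ : (x,y) ↦ (1/(1−x), y/(x−1)³)`. -/
theorem d6_model_characterisation {k : Type*} [Field k] :
    (∀ c₀ c₁ c₂ c₃ : k,
      (C c₀ * (X - 1) ^ 3 - C c₁ * (X - 1) ^ 2 + C c₂ * (X - 1) - C c₃ =
          C c₃ * X ^ 3 + C c₂ * X ^ 2 + C c₁ * X + C c₀) ↔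
        (c₃ = c₀ ∧ c₂ = -(c₁ + 3 * c₀))) ∧
    (∀ a : Fin 7 → k,
      (∑ i : Fin 7, C (a i) * (-1) ^ (i : ℕ) * (X - 1) ^ (6 - (i : ℕ)) =
          ∑ i : Fin 7, C (a i) * X ^ (i : ℕ)) ↔
        ∃ f₀ f₁ f₂ : k,
          (∑ i : Fin 7, C (a i) * X ^ (i : ℕ)) =
            C f₀ * X ^ 6 - C (f₁ + 6 * f₀) * X ^ 5 + C (f₂ + 5 * f₁ + 15 * f₀) * X ^ 4 -
              C (2 * f₂ + 5 * f₁ + 10 * f₀) * X ^ 3 + C f₂ * X ^ 2 + C f₁ * X + C f₀) := by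
  refine ⟨fun c₀ c₁ c₂ c₃ => ?_, fun a => ?_⟩
  · have hr : C c₃ * X ^ 3 + C c₂ * X ^ 2 + C c₁ * X + C c₀ =
        ∑ i : Fin 4, C (![c₀, c₁, c₂, c₃] i) * X ^ (i : ℕ) := by
      simp [Fin.sum_univ_four]
      ring
    rw [twisted_cubic_expand, hr, sum_fin_C_mul_X_pow_inj]
    constructor
    · intro h
      have h2 := congrFun h 2
      have h3 := congrFun h 3
      simp at h2 h3
      exact ⟨h3.symm, by linear_combination -h2⟩
    · rintro ⟨rfl, rfl⟩
      funext i
      fin_cases i <;> simp <;> ring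
  · have hr (f₀ f₁ f₂ : k) :
        C f₀ * X ^ 6 - C (f₁ + 6 * f₀) * X ^ 5 + C (f₂ + 5 * f₁ + 15 * f₀) * X ^ 4 -
            C (2 * f₂ + 5 * f₁ + 10 * f₀) * X ^ 3 + C f₂ * X ^ 2 + C f₁ * X + C f₀ =
          ∑ i : Fin 7, C (![f₀, f₁, f₂, -(2 * f₂ + 5 * f₁ + 10 * f₀),
            f₂ + 5 * f₁ + 15 * f₀, -(f₁ + 6 * f₀), f₀] i) * X ^ (i : ℕ) := by
      simp [Fin.sum_univ_seven]
      ring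
    simp only [twisted_sextic_expand, hr, sum_fin_C_mul_X_pow_inj]
    constructor
    · intro h
      have h2 := congrFun h 2
      have h3 := congrFun h 3
      have h4 := congrFun h 4
      have h5 := congrFun h 5
      have h6 := congrFun h 6
      simp at h2 h3 h4 h5 h6
      refine ⟨a 0, a 1, a 2, ?_⟩
      funext i
      fin_cases i <;> simp
      -- The `X²` and `X³` coefficients give `3 * a 3` and `2 * a 3`; subtract.
      · linear_combination h2 + h3 + h4
      · linear_combination -h4
      · linear_combination -h5
      · exact h6.symm
    · rintro ⟨f₀, f₁, f₂, rfl⟩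
      funext i
      fin_cases i <;> simp <;> ring
end
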